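/- arXiv:2310.11180 — 8 statements merged into one kernel-verified Lean document; each statement's English description precedes it below -/
import Mathlib

section
/- Let L be an extraspecial left Leibniz algebra over a field F with dim_F(L) = n+1, Z = ζ(L), and G = Aut(L). Then the normal subgroup C_G(L/Z) = {f ∈ G : f(x) − x ∈ Z for all x ∈ L} is isomorphic, as a group, to the direct product of n copies of the additive group of F. -/
/-- A (left) Leibniz algebra over a field `F`: a vector space with a bilinear
bracket satisfying the left Leibniz identity. -/
structure LeibnizAlg (F : Type*) [Field F] (L : Type*) [AddCommGroup L] [Module F L] where
  bracket : L →ₗ[F] L →ₗ[F] L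
  leibniz : ∀ a b c : L,
    bracket (bracket a b) c = bracket a (bracket b c) - bracket b (bracket a c)

namespace LeibnizAlg

variable {F : Type*} [Field F] {L : Type*} [AddCommGroup L] [Module F L]

/-- The left center `ζ^left(L)`. -/
def leftCenter (A : LeibnizAlg F L) : Submodule F L where
  carrier := {x | ∀ y : L, A.bracket x y = 0}
  add_mem' := by
    intro a b ha hb y
    simp [map_add, LinearMap.add_apply, ha y, hb y]
  zero_mem' := by intro y; simp
  smul_mem' := by
    intro c x hx y
    simp [map_smul, LinearMap.smul_apply, hx y]

/-- The right center `ζ^right(L)`. -/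
def rightCenter (A : LeibnizAlg F L) : Submodule F L where
  carrier := {x | ∀ y : L, A.bracket y x = 0}
  add_mem' := by
    intro a b ha hb y
    simp [ha y, hb y]
  zero_mem' := by intro y; simp
  smul_mem' := by
    intro c x hx y
    simp [hx y]

/-- The center `ζ(L)`. -/
def center (A : LeibnizAlg F L) : Submodule F L := A.leftCenter ⊓ A.rightCenter

/-- The derived subalgebra `[L,L]`. -/
def derived (A : LeibnizAlg F L) : Submodule F L :=
  Submodule.span F {z | ∃ a b : L, z = A.bracket a b}

/-- The Leibniz kernel `Leib(L)`, spanned by the squares `[a,a]`. -/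
def leibKernel (A : LeibnizAlg F L) : Submodule F L :=
  Submodule.span F {z | ∃ a : L, z = A.bracket a a}

/-- Upper central series: `upper 0 = ⊥ = ζ₀(L)`, `upper (n+1) = ζ_{n+1}(L)`. -/
def upper (A : LeibnizAlg F L) : ℕ → Submodule F L
  | 0 => ⊥
  | n + 1 =>
    { carrier := {x | ∀ y : L, A.bracket x y ∈ A.upper n ∧ A.bracket y x ∈ A.upper n}
      add_mem' := by
        intro a b ha hb y
        constructor
        · simpa [map_add, LinearMap.add_apply] using add_mem (ha y).1 (hb y).1
        · simpa [map_add] using add_mem (ha y).2 (hb y).2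
      zero_mem' := by
        intro y
        constructor <;> simp
      smul_mem' := by
        intro c x hx y
        constructor
        · simpa [map_smul, LinearMap.smul_apply] using Submodule.smul_mem _ c (hx y).1
        · simpa [map_smul] using Submodule.smul_mem _ c (hx y).2 }

/-- Lower central series: `lower 0 = ⊤ = γ₁(L)`, `lower n = γ_{n+1}(L)`. -/
def lower (A : LeibnizAlg F L) : ℕ → Submodule F L
  | 0 => ⊤
  | n + 1 => Submodule.span F {z | ∃ x a : L, a ∈ A.lower n ∧ z = A.bracket x a}

/-- The automorphism group of a Leibniz algebra, as a subgroup of the group of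
linear automorphisms of the underlying vector space. -/
def Aut (A : LeibnizAlg F L) : Subgroup (L ≃ₗ[F] L) where
  carrier := {f | ∀ a b : L, f (A.bracket a b) = A.bracket (f a) (f b)}
  mul_mem' := by
    intro f g hf hg a b
    show f (g (A.bracket a b)) = A.bracket (f (g a)) (f (g b))
    rw [hg, hf]
  one_mem' := by intro a b; rfl
  inv_mem' := by
    intro f hf a b
    apply f.injective
    show f (f.symm (A.bracket a b)) = f (A.bracket (f.symm a) (f.symm b))
    rw [hf, f.apply_symm_apply, f.apply_symm_apply, f.apply_symm_apply]

/-- The group `B(V,Φ)` of linear automorphisms of `V` preserving the bilinear form `Φ`. -/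
def formPreserving (F : Type*) [Field F] (V : Type*) [AddCommGroup V] [Module F V]
    (Φ : V →ₗ[F] V →ₗ[F] F) : Subgroup (V ≃ₗ[F] V) where
  carrier := {g | ∀ x y : V, Φ (g x) (g y) = Φ x y}
  mul_mem' := by
    intro f g hf hg x y
    show Φ (f (g x)) (f (g y)) = Φ x y
    rw [hf, hg]
  one_mem' := by intro x y; rfl
  inv_mem' := by
    intro f hf x y
    have h := hf (f.symm x) (f.symm y)
    rw [f.apply_symm_apply, f.apply_symm_apply] at h
    exact h.symm

/-- The subalgebra generated by an element `b`. -/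
def genBy (A : LeibnizAlg F L) (b : L) : Submodule F L :=
  sInf {S : Submodule F L | b ∈ S ∧ ∀ x ∈ S, ∀ y ∈ S, A.bracket x y ∈ S}

end LeibnizAlg

/-- The bilinear bracket of the algebra `Lei₄(3,F)`:
`[x,y] = (x₀y₀ + λ x₁y₁)·a₃` where `a₃ = (0,0,1)`. -/
def leiBracket (F : Type*) [Field F] (lam : F) :
    (Fin 3 → F) →ₗ[F] (Fin 3 → F) →ₗ[F] (Fin 3 → F) :=
  LinearMap.mk₂ F (fun x y => (x 0 * y 0 + lam * (x 1 * y 1)) • (![0, 0, 1] : Fin 3 → F))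
    (by
      intro x x' y
      rw [← add_smul]
      simp only [Pi.add_apply]
      ring_nf)
    (by
      intro c x y
      rw [smul_smul]
      simp only [Pi.smul_apply, smul_eq_mul]
      ring_nf)
    (by
      intro x y y'
      rw [← add_smul]
      simp only [Pi.add_apply]
      ring_nf)
    (by
      intro c x y
      rw [smul_smul]
      simp only [Pi.smul_apply, smul_eq_mul]
      ring_nf)

/-- The Leibniz algebra `Lei₄(3,F)` with parameter `λ`. -/
def lei4 (F : Type*) [Field F] (lam : F) : LeibnizAlg F (Fin 3 → F) where
  bracket := leiBracket F lam
  leibniz := by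
    intro a b c
    simp [leiBracket, LinearMap.mk₂_apply]

namespace LeibnizAlg

variable {F : Type*} [Field F] {L : Type*} [AddCommGroup L] [Module F L]

lemma bracket_congr_center (A : LeibnizAlg F L) {a b c d : L}
    (ha : c - a ∈ A.center) (hb : d - b ∈ A.center) :
    A.bracket c d = A.bracket a b := by
  have h1 : A.bracket (c - a) d = 0 := ha.1 d
  have h2 : A.bracket a (d - b) = 0 := hb.2 a
  rw [map_sub, LinearMap.sub_apply, sub_eq_zero] at h1
  rw [map_sub, sub_eq_zero] at h2
  rw [h1, h2]

lemma aut_center (A : LeibnizAlg F L) (g : A.Aut) {z : L} (hz : z ∈ A.center) :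
    (g : L ≃ₗ[F] L) z ∈ A.center := by
  have hg : ∀ a b : L, (g : L ≃ₗ[F] L) (A.bracket a b)
      = A.bracket ((g : L ≃ₗ[F] L) a) ((g : L ≃ₗ[F] L) b) := g.2
  refine ⟨fun y => ?_, fun y => ?_⟩
  · obtain ⟨w, rfl⟩ := (g : L ≃ₗ[F] L).surjective y
    rw [← hg, hz.1 w, map_zero]
  · obtain ⟨w, rfl⟩ := (g : L ≃ₗ[F] L).surjective y
    rw [← hg, hz.2 w, map_zero]

/-- The linear map `x ↦ x + φ (x + Z)`. -/
def shiftMap (A : LeibnizAlg F L) (φ : (L ⧸ A.center) →ₗ[F] A.center) : L →ₗ[F] L :=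
  LinearMap.id + A.center.subtype ∘ₗ φ ∘ₗ A.center.mkQ

lemma shiftMap_apply (A : LeibnizAlg F L) (φ : (L ⧸ A.center) →ₗ[F] A.center) (x : L) :
    A.shiftMap φ x = x + (φ (A.center.mkQ x) : L) := rfl

lemma shiftMap_add (A : LeibnizAlg F L) (φ ψ : (L ⧸ A.center) →ₗ[F] A.center) (x : L) :
    A.shiftMap φ (A.shiftMap ψ x) = A.shiftMap (φ + ψ) x := by
  have h : A.center.mkQ (ψ (A.center.mkQ x) : L) = 0 := by
    rw [Submodule.mkQ_apply, Submodule.Quotient.mk_eq_zero]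
    exact (ψ (A.center.mkQ x)).2
  simp only [shiftMap_apply, map_add, h, map_zero, LinearMap.add_apply, Submodule.coe_add,
    Submodule.coe_zero, add_zero]
  abel

lemma shiftMap_zero (A : LeibnizAlg F L) (x : L) : A.shiftMap 0 x = x := by
  simp [shiftMap_apply]

/-- The linear automorphism `x ↦ x + φ (x + Z)`. -/
def shiftEquiv (A : LeibnizAlg F L) (φ : (L ⧸ A.center) →ₗ[F] A.center) : L ≃ₗ[F] L :=
  LinearEquiv.ofLinearMap (A.shiftMap φ) (A.shiftMap (-φ))
    (by ext x; simp only [LinearMap.comp_apply, shiftMap_add, add_neg_cancel, shiftMap_zero,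
          LinearMap.id_apply])
    (by ext x; simp only [LinearMap.comp_apply, shiftMap_add, neg_add_cancel, shiftMap_zero,
          LinearMap.id_apply])

lemma shiftEquiv_apply (A : LeibnizAlg F L) (φ : (L ⧸ A.center) →ₗ[F] A.center) (x : L) :
    A.shiftEquiv φ x = A.shiftMap φ x := rfl

lemma shiftMap_sub_mem (A : LeibnizAlg F L) (φ : (L ⧸ A.center) →ₗ[F] A.center) (x : L) :
    A.shiftMap φ x - x ∈ A.center := by
  rw [shiftMap_apply, add_sub_cancel_left]
  exact (φ (A.center.mkQ x)).2

lemma bracket_mem_center (A : LeibnizAlg F L) (h : A.derived = A.center) (a b : L) :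
    A.bracket a b ∈ A.center := by
  rw [← h]
  exact Submodule.subset_span ⟨a, b, rfl⟩

/-- The homomorphism `Hom(L/Z, Z) → Aut L`. -/
def shiftHom (A : LeibnizAlg F L) (h : A.derived = A.center) :
    Multiplicative ((L ⧸ A.center) →ₗ[F] A.center) →* A.Aut where
  toFun φ := ⟨A.shiftEquiv φ.toAdd, by
    intro a b
    rw [shiftEquiv_apply, shiftEquiv_apply, shiftEquiv_apply,
      A.bracket_congr_center (A.shiftMap_sub_mem _ a) (A.shiftMap_sub_mem _ b), shiftMap_apply,
      Submodule.mkQ_apply, (Submodule.Quotient.mk_eq_zero _).2 (A.bracket_mem_center h a b)]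
    simp⟩
  map_one' := by
    apply Subtype.ext
    ext x
    exact A.shiftMap_zero x
  map_mul' φ ψ := by
    apply Subtype.ext
    ext x
    exact (A.shiftMap_add φ.toAdd ψ.toAdd x).symm

lemma shiftHom_apply (A : LeibnizAlg F L) (h : A.derived = A.center)
    (φ : Multiplicative ((L ⧸ A.center) →ₗ[F] A.center)) (x : L) :
    (A.shiftHom h φ : L ≃ₗ[F] L) x = A.shiftMap φ.toAdd x := rfl

lemma shiftHom_injective (A : LeibnizAlg F L) (h : A.derived = A.center) :
    Function.Injective (A.shiftHom h) := by
  intro φ ψ hφ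
  apply Multiplicative.toAdd.injective
  apply LinearMap.ext
  intro q
  obtain ⟨x, rfl⟩ := A.center.mkQ_surjective q
  have := congrArg (fun f : A.Aut => (f : L ≃ₗ[F] L) x) hφ
  simp only [shiftHom_apply, shiftMap_apply] at this
  exact Subtype.ext (add_left_cancel this)

lemma mem_range_shiftHom (A : LeibnizAlg F L) (h : A.derived = A.center) (f : A.Aut) :
    f ∈ (A.shiftHom h).range ↔ ∀ x : L, (f : L ≃ₗ[F] L) x - x ∈ A.center := by
  constructor
  · rintro ⟨φ, rfl⟩ x
    exact A.shiftMap_sub_mem _ x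
  · intro hf
    have hfb : ∀ a b : L, (f : L ≃ₗ[F] L) (A.bracket a b)
      = A.bracket ((f : L ≃ₗ[F] L) a) ((f : L ≃ₗ[F] L) b) := f.2
    let d : L →ₗ[F] L := ((f : L ≃ₗ[F] L) : L →ₗ[F] L) - LinearMap.id
    have hd : ∀ x, d x ∈ A.center := hf
    have hk : A.center ≤ LinearMap.ker (d.codRestrict A.center hd) := by
      rw [LinearMap.ker_codRestrict, ← h, derived, Submodule.span_le]
      rintro z ⟨a, b, rfl⟩
      change (f : L ≃ₗ[F] L) (A.bracket a b) - A.bracket a b = 0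
      rw [hfb, A.bracket_congr_center (hf a) (hf b), sub_self]
    refine ⟨Multiplicative.ofAdd (A.center.liftQ (d.codRestrict A.center hd) hk), ?_⟩
    apply Subtype.ext
    ext x
    rw [shiftHom_apply, shiftMap_apply]
    change x + ((f : L ≃ₗ[F] L) x - x) = _
    abel

end LeibnizAlg

/-- for an extraspecial Leibniz algebra `L` of dimension `n+1` with
center `Z`, the normal subgroup `C_G(L/Z)` of `G = Aut(L)` is isomorphic to the
direct product of `n` copies of the additive group of `F`. -/
theorem central_aut_iso_additive_power
    {F : Type*} [Field F] {L : Type*} [AddCommGroup L] [Module F L]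
    (A : LeibnizAlg F L) (n : ℕ)
    (hextra : A.derived = A.center)
    (hdim : Module.finrank F A.center = 1)
    (hL : Module.finrank F L = n + 1) :
    ∃ C : Subgroup A.Aut, C.Normal ∧
      (∀ f : A.Aut, f ∈ C ↔ ∀ x : L, (f : L ≃ₗ[F] L) x - x ∈ A.center) ∧
      Nonempty (C ≃* Multiplicative (Fin n → F)) := by
  have : FiniteDimensional F L := Module.finite_of_finrank_pos (by omega)
  refine ⟨(A.shiftHom hextra).range, ⟨?_⟩, A.mem_range_shiftHom hextra, ?_⟩
  · intro f hf g
    rw [A.mem_range_shiftHom] at hf ⊢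
    intro x
    obtain ⟨y, rfl⟩ := (g : L ≃ₗ[F] L).surjective x
    have h1 : ((g * f * g⁻¹ : A.Aut) : L ≃ₗ[F] L) ((g : L ≃ₗ[F] L) y)
        = (g : L ≃ₗ[F] L) ((f : L ≃ₗ[F] L) y) := by
      change (g : L ≃ₗ[F] L) ((f : L ≃ₗ[F] L)
        ((g : L ≃ₗ[F] L).symm ((g : L ≃ₗ[F] L) y))) = _
      rw [LinearEquiv.symm_apply_apply]
    rw [h1, ← map_sub]
    exact A.aut_center g (hf y)
  · have hq := A.center.finrank_quotient_add_finrank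
    have e : ((L ⧸ A.center) →ₗ[F] A.center) ≃ₗ[F] (Fin n → F) :=
      LinearEquiv.ofFinrankEq _ _ (by
        rw [Module.finrank_linearMap, hdim, Module.finrank_fin_fun]
        omega)
    exact ⟨(MonoidHom.ofInjective (A.shiftHom_injective hextra)).symm.trans
      (AddEquiv.toMultiplicative e.toAddEquiv)⟩
end

section
/- Let F be a field of characteristic 2, λ ∈ F nonzero, and L = Lei₄(3,F). A bijective F-linear map f : L → L is an automorphism of L if and only if there exist α₁, α₂, α₃, β₃ ∈ F with α₁² + λα₂² ≠ 0 such that f(a₁) = α₁a₁ + α₂a₂ + α₃a₃, f(a₂) = λα₂a₁ + α₁a₂ + β₃a₃, and f(a₃) = (α₁² + λα₂²)a₃. Equivalently, the image of Aut(L) under the canonical embedding into GL₃(F) given by the basis (a₁,a₂,a₃) consists exactly of the invertible matrices whose columns (the coordinate vectors of f(a₁), f(a₂), f(a₃)) are (α₁, α₂, α₃), (λα₂, α₁, β₃), (0, 0, α₁² + λα₂²). -/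
/-- over a field of characteristic 2, a bijective linear map `f` of
`Lei₄(3,F)` (basis `a₁ = ![1,0,0]`, `a₂ = ![0,1,0]`, `a₃ = ![0,0,1]`) is an
automorphism iff there are `α₁ α₂ α₃ β₃` with `α₁² + λα₂² ≠ 0` such that
`f(a₁) = α₁a₁ + α₂a₂ + α₃a₃`, `f(a₂) = λα₂a₁ + α₁a₂ + β₃a₃`,
`f(a₃) = (α₁² + λα₂²)a₃`. -/
theorem lei4_aut_char_two
    (F : Type*) [Field F] [CharP F 2] (lam : F) (hlam : lam ≠ 0)
    (f : (Fin 3 → F) ≃ₗ[F] (Fin 3 → F)) :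
    (∀ a b : Fin 3 → F,
        f ((lei4 F lam).bracket a b) = (lei4 F lam).bracket (f a) (f b)) ↔
    ∃ α₁ α₂ α₃ β₃ : F, α₁ ^ 2 + lam * α₂ ^ 2 ≠ 0 ∧
      f ![1, 0, 0] = α₁ • ![1, 0, 0] + α₂ • ![0, 1, 0] + α₃ • ![0, 0, 1] ∧
      f ![0, 1, 0] = (lam * α₂) • ![1, 0, 0] + α₁ • ![0, 1, 0] + β₃ • ![0, 0, 1] ∧
      f ![0, 0, 1] = (α₁ ^ 2 + lam * α₂ ^ 2) • ![0, 0, 1] := by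
  constructor
  · intro h
    have key : ∀ a b : Fin 3 → F, (a 0 * b 0 + lam * (a 1 * b 1)) • f ![0, 0, 1] =
        (f a 0 * f b 0 + lam * (f a 1 * f b 1)) • (![0, 0, 1] : Fin 3 → F) := by
      intro a b
      have h1 := h a b
      simp only [lei4, leiBracket, LinearMap.mk₂_apply, map_smul] at h1
      exact h1
    have h11 := key ![1, 0, 0] ![1, 0, 0]
    have h12 := key ![1, 0, 0] ![0, 1, 0]
    have h22 := key ![0, 1, 0] ![0, 1, 0]
    have hne : f ![0, 0, 1] ≠ 0 := by
      intro h0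
      have h1 := f.map_eq_zero_iff.mp h0
      have h2 := congrFun h1 2
      simp at h2
    generalize f ![0, 0, 1] = w at *
    generalize hv : f ![0, 1, 0] = v at *
    generalize hu : f ![1, 0, 0] = u at *
    have e11 : w = (u 0 * u 0 + lam * (u 1 * u 1)) • (![0, 0, 1] : Fin 3 → F) := by
      simpa using h11
    have e12 : u 0 * v 0 + lam * (u 1 * v 1) = 0 := by
      have h1 := congrFun h12 2
      simpa using h1.symm
    have e22 : lam * (u 0 * u 0 + lam * (u 1 * u 1)) = v 0 * v 0 + lam * (v 1 * v 1) := by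
      rw [e11] at h22
      have h1 := congrFun h22 2
      simpa using h1
    have hD : u 0 ^ 2 + lam * u 1 ^ 2 ≠ 0 := by
      intro h0
      apply hne
      rw [e11, show u 0 * u 0 + lam * (u 1 * u 1) = 0 by rw [← h0]; ring, zero_smul]
    have two : (2 : F) = 0 := CharTwo.two_eq_zero
    have sq : ∀ x y : F, x ^ 2 = y ^ 2 → x = y := by
      intro x y hxy
      have h1 : (x - y) ^ 2 = 0 := by linear_combination hxy + (y ^ 2 - x * y) * two
      exact sub_eq_zero.mp (pow_eq_zero_iff (two_ne_zero) |>.mp h1)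
    have ht : v 1 = u 0 := by
      apply sq
      apply mul_left_cancel₀ hlam
      apply mul_left_cancel₀ hD
      linear_combination (-(u 0)^2) * e22 - (u 0 * v 0 - lam * (u 1 * v 1)) * e12
    have hs : v 0 = lam * u 1 := by
      apply sq
      rw [ht] at e22
      linear_combination -e22
    refine ⟨u 0, u 1, u 2, v 2, hD, ?_, ?_, ?_⟩
    · ext i; fin_cases i <;> simp
    · ext i; fin_cases i <;> simp [hs, ht]
    · rw [e11]; congr 1; ring
  · rintro ⟨p, q, r, s, -, h1, h2, h3⟩ a b
    have two : (2 : F) = 0 := CharTwo.two_eq_zero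
    have dec : ∀ x : Fin 3 → F,
        f x = x 0 • f ![1, 0, 0] + x 1 • f ![0, 1, 0] + x 2 • f ![0, 0, 1] := by
      intro x
      rw [← map_smul, ← map_smul, ← map_smul, ← map_add, ← map_add]
      congr 1
      ext i; fin_cases i <;> simp
    have c0 : ∀ x, f x 0 = x 0 * p + x 1 * (lam * q) := by
      intro x; rw [dec, h1, h2, h3]; simp
    have c1 : ∀ x, f x 1 = x 0 * q + x 1 * p := by
      intro x; rw [dec, h1, h2, h3]; simp
    simp only [lei4, leiBracket, LinearMap.mk₂_apply, map_smul]
    rw [h3, smul_smul, c0, c0, c1, c1]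
    congr 1
    linear_combination (-lam * p * q * (a 0 * b 1 + a 1 * b 0)) * two
end

section
/- Let F be a field of characteristic different from 2, λ ∈ F nonzero, and L = Lei₄(3,F). A bijective F-linear map f : L → L is an automorphism of L if and only if there exist α₁, α₂, α₃, β₃ ∈ F and δ ∈ {1, −1} with α₁² + λα₂² ≠ 0 such that f(a₁) = α₁a₁ + α₂a₂ + α₃a₃, f(a₂) = δλα₂a₁ − δα₁a₂ + β₃a₃, and f(a₃) = (α₁² + λα₂²)a₃. Equivalently, the image of Aut(L) under the canonical embedding into GL₃(F) given by the basis (a₁,a₂,a₃) consists exactly of the invertible matrices whose columns are (α₁, α₂, α₃), (δλα₂, −δα₁, β₃), (0, 0, α₁² + λα₂²). -/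
/-- over a field of characteristic ≠ 2, a bijective linear map `f` of
`Lei₄(3,F)` (basis `a₁ = ![1,0,0]`, `a₂ = ![0,1,0]`, `a₃ = ![0,0,1]`) is an
automorphism iff there are `α₁ α₂ α₃ β₃` and `δ ∈ {1,-1}` with
`α₁² + λα₂² ≠ 0` such that `f(a₁) = α₁a₁ + α₂a₂ + α₃a₃`,
`f(a₂) = δλα₂a₁ - δα₁a₂ + β₃a₃`, `f(a₃) = (α₁² + λα₂²)a₃`. -/
theorem lei4_aut_char_ne_two
    (F : Type*) [Field F] (hchar : (2 : F) ≠ 0) (lam : F) (hlam : lam ≠ 0)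
    (f : (Fin 3 → F) ≃ₗ[F] (Fin 3 → F)) :
    (∀ a b : Fin 3 → F,
        f ((lei4 F lam).bracket a b) = (lei4 F lam).bracket (f a) (f b)) ↔
    ∃ α₁ α₂ α₃ β₃ δ : F, (δ = 1 ∨ δ = -1) ∧ α₁ ^ 2 + lam * α₂ ^ 2 ≠ 0 ∧
      f ![1, 0, 0] = α₁ • ![1, 0, 0] + α₂ • ![0, 1, 0] + α₃ • ![0, 0, 1] ∧
      f ![0, 1, 0] = (δ * lam * α₂) • ![1, 0, 0] + (-(δ * α₁)) • ![0, 1, 0]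
          + β₃ • ![0, 0, 1] ∧
      f ![0, 0, 1] = (α₁ ^ 2 + lam * α₂ ^ 2) • ![0, 0, 1] := by
  have hbr : ∀ x y : Fin 3 → F, (lei4 F lam).bracket x y
      = (x 0 * y 0 + lam * (x 1 * y 1)) • (![0, 0, 1] : Fin 3 → F) := by
    intro x y
    simp [lei4, leiBracket, LinearMap.mk₂_apply]
  constructor
  · intro h
    have h11 := h ![1, 0, 0] ![1, 0, 0]
    have h12 := h ![1, 0, 0] ![0, 1, 0]
    have h22 := h ![0, 1, 0] ![0, 1, 0]
    rw [hbr, hbr, map_smul] at h11 h12 h22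
    have e3 : f ![0, 0, 1] = ((f ![1, 0, 0] 0) ^ 2 + lam * (f ![1, 0, 0] 1) ^ 2) •
        (![0, 0, 1] : Fin 3 → F) := by
      simpa [pow_two] using h11
    have hN : (f ![1, 0, 0] 0) ^ 2 + lam * (f ![1, 0, 0] 1) ^ 2 ≠ 0 := by
      intro h0
      rw [h0, zero_smul] at e3
      have h1 : (![0, 0, 1] : Fin 3 → F) = 0 := f.injective (by rw [e3, map_zero])
      have h2 := congrFun h1 2
      simp at h2
    rw [e3] at h12 h22
    have k12 := congrFun h12 2
    have k22 := congrFun h22 2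
    simp at k12 k22
    have eta : ∀ v : Fin 3 → F,
        v = v 0 • ![1, 0, 0] + v 1 • ![0, 1, 0] + v 2 • ![0, 0, 1] := by
      intro v
      ext i
      fin_cases i <;> simp
    generalize f ![1, 0, 0] = v at *
    generalize f ![0, 1, 0] = w at *
    obtain ⟨k, hk⟩ : ∃ k, k * (v 0 ^ 2 + lam * v 1 ^ 2) = w 0 * v 1 - w 1 * v 0 :=
      ⟨_, div_mul_cancel₀ _ hN⟩
    have hw0 : w 0 = k * lam * v 1 := by
      apply mul_right_cancel₀ hN
      linear_combination (-lam * v 1) * hk - v 0 * k12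
    have hw1 : w 1 = -(k * v 0) := by
      apply mul_right_cancel₀ hN
      linear_combination (v 0) * hk - v 1 * k12
    have hk2 : (k - 1) * (k + 1) = 0 := by
      apply mul_right_cancel₀ (mul_ne_zero hlam hN)
      rw [hw0, hw1] at k22
      linear_combination -k22
    refine ⟨v 0, v 1, v 2, w 2, k, ?_, hN, eta v, ?_, e3⟩
    · rcases mul_eq_zero.mp hk2 with h | h
      · left; linear_combination h
      · right; linear_combination h
    · rw [← hw0, ← hw1]; exact eta w
  · rintro ⟨p, q, r, u, δ, hδ, hN, h1, h2, h3⟩ a b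
    have hδ2 : δ ^ 2 = 1 := by rcases hδ with h | h <;> rw [h] <;> ring
    have hf : ∀ v : Fin 3 → F,
        f v = v 0 • f ![1, 0, 0] + v 1 • f ![0, 1, 0] + v 2 • f ![0, 0, 1] := by
      intro v
      rw [← map_smul, ← map_smul, ← map_smul, ← map_add, ← map_add]
      congr 1
      ext i
      fin_cases i <;> simp
    rw [hbr, hbr, map_smul, hf a, hf b, h1, h2, h3, smul_smul]
    congr 1
    simp
    linear_combination (-lam * a 1 * b 1 * (p ^ 2 + lam * q ^ 2)) * hδ2
end

section
/- Let F be a field, λ ∈ F nonzero, L = Lei₄(3,F), and G = Aut(L). Then C = C_G(L/ζ(L)) = {f ∈ G : f(x) − x ∈ ζ(L) for all x ∈ L} is a normal subgroup of G consisting exactly of the maps f with f(a₁) = a₁ + α₃a₃, f(a₂) = a₂ + β₃a₃, f(a₃) = a₃ for α₃, β₃ ∈ F, and C is isomorphic, as a group, to the direct product of two copies of the additive group of F. -/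
theorem lei4_bracket_apply {F : Type*} [Field F] (lam : F) (x y : Fin 3 → F) :
    (lei4 F lam).bracket x y = (x 0 * y 0 + lam * (x 1 * y 1)) • (![0, 0, 1] : Fin 3 → F) := rfl

theorem lei4_mem_center {F : Type*} [Field F] (lam : F) (hlam : lam ≠ 0) (x : Fin 3 → F) :
    x ∈ (lei4 F lam).center ↔ x 0 = 0 ∧ x 1 = 0 := by
  constructor
  · rintro ⟨h, -⟩
    have h0 := congrFun (h ![1, 0, 0]) 2
    have h1 := congrFun (h ![0, 1, 0]) 2
    rw [lei4_bracket_apply] at h0 h1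
    simp at h0 h1
    exact ⟨h0, h1.resolve_left hlam⟩
  · rintro ⟨h0, h1⟩
    refine ⟨fun y => ?_, fun y => ?_⟩ <;> rw [lei4_bracket_apply] <;> simp [h0, h1]

/-- The linear automorphism adding a multiple of `a₃`. -/
def lei4Shift (F : Type*) [Field F] (p : F × F) : (Fin 3 → F) ≃ₗ[F] (Fin 3 → F) where
  toFun x := x + (p.1 * x 0 + p.2 * x 1) • (![0, 0, 1] : Fin 3 → F)
  invFun x := x - (p.1 * x 0 + p.2 * x 1) • (![0, 0, 1] : Fin 3 → F)
  map_add' x y := by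
    ext i; fin_cases i <;> simp [Matrix.vecHead, Matrix.vecTail] <;> ring
  map_smul' c x := by
    ext i; fin_cases i <;> simp [Matrix.vecHead, Matrix.vecTail]; ring
  left_inv x := by
    ext i; fin_cases i <;> simp [Matrix.vecHead, Matrix.vecTail]
  right_inv x := by
    ext i; fin_cases i <;> simp [Matrix.vecHead, Matrix.vecTail]

theorem lei4Shift_apply {F : Type*} [Field F] (p : F × F) (x : Fin 3 → F) :
    lei4Shift F p x = x + (p.1 * x 0 + p.2 * x 1) • (![0, 0, 1] : Fin 3 → F) := rfl

/-- The shifts as a group homomorphism into the automorphism group. -/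
def lei4ShiftHom (F : Type*) [Field F] (lam : F) :
    Multiplicative (F × F) →* (lei4 F lam).Aut where
  toFun p := ⟨lei4Shift F p.toAdd, by
    intro a b
    rw [lei4_bracket_apply, lei4_bracket_apply]
    simp only [lei4Shift_apply]
    ext i; fin_cases i <;> simp⟩
  map_one' := by
    apply Subtype.ext
    apply LinearEquiv.ext
    intro x
    show lei4Shift F 0 x = x
    simp [lei4Shift_apply]
  map_mul' p q := by
    apply Subtype.ext
    apply LinearEquiv.ext
    intro x
    show lei4Shift F (p.toAdd + q.toAdd) x = lei4Shift F p.toAdd (lei4Shift F q.toAdd x)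
    simp only [lei4Shift_apply]
    ext i; fin_cases i <;> simp [Matrix.vecHead, Matrix.vecTail]
    ring

theorem lei4ShiftHom_apply {F : Type*} [Field F] (lam : F) (p : Multiplicative (F × F))
    (x : Fin 3 → F) : (lei4ShiftHom F lam p : (Fin 3 → F) ≃ₗ[F] (Fin 3 → F)) x =
      x + (p.toAdd.1 * x 0 + p.toAdd.2 * x 1) • (![0, 0, 1] : Fin 3 → F) := rfl

theorem lei4ShiftHom_injective (F : Type*) [Field F] (lam : F) :
    Function.Injective (lei4ShiftHom F lam) := by
  intro p q h
  have key : ∀ x : Fin 3 → F, (lei4ShiftHom F lam p : (Fin 3 → F) ≃ₗ[F] (Fin 3 → F)) x =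
      (lei4ShiftHom F lam q : (Fin 3 → F) ≃ₗ[F] (Fin 3 → F)) x := fun x => by rw [h]
  have h0 := congrFun (key ![1, 0, 0]) 2
  have h1 := congrFun (key ![0, 1, 0]) 2
  rw [lei4ShiftHom_apply, lei4ShiftHom_apply] at h0 h1
  simp at h0 h1
  apply Multiplicative.toAdd.injective
  exact Prod.ext h0 h1

theorem lei4_mem_range_iff_basis {F : Type*} [Field F] (lam : F) (f : (lei4 F lam).Aut) :
    f ∈ (lei4ShiftHom F lam).range ↔
      ∃ α₃ β₃ : F,
        (f : (Fin 3 → F) ≃ₗ[F] (Fin 3 → F)) ![1, 0, 0] = ![1, 0, 0] + α₃ • ![0, 0, 1] ∧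
        (f : (Fin 3 → F) ≃ₗ[F] (Fin 3 → F)) ![0, 1, 0] = ![0, 1, 0] + β₃ • ![0, 0, 1] ∧
        (f : (Fin 3 → F) ≃ₗ[F] (Fin 3 → F)) ![0, 0, 1] = ![0, 0, 1] := by
  constructor
  · rintro ⟨p, rfl⟩
    refine ⟨p.toAdd.1, p.toAdd.2, ?_, ?_, ?_⟩ <;> rw [lei4ShiftHom_apply] <;> simp
  · rintro ⟨α, β, h0, h1, h2⟩
    refine ⟨Multiplicative.ofAdd (α, β), ?_⟩
    apply Subtype.ext
    apply LinearEquiv.ext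
    intro x
    have hx : x = x 0 • ![1, 0, 0] + x 1 • ![0, 1, 0] + x 2 • ![0, 0, 1] := by
      ext i; fin_cases i <;> simp
    rw [lei4ShiftHom_apply]
    conv_rhs => rw [hx]
    rw [map_add, map_add, map_smul, map_smul, map_smul, h0, h1, h2]
    ext i; fin_cases i <;> simp
    ring

theorem lei4_mem_range_iff_center {F : Type*} [Field F] (lam : F) (hlam : lam ≠ 0)
    (f : (lei4 F lam).Aut) :
    f ∈ (lei4ShiftHom F lam).range ↔
      ∀ x : Fin 3 → F,
        (f : (Fin 3 → F) ≃ₗ[F] (Fin 3 → F)) x - x ∈ (lei4 F lam).center := by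
  constructor
  · rintro ⟨p, rfl⟩ x
    rw [lei4_mem_center lam hlam, lei4ShiftHom_apply]
    simp [Matrix.vecHead, Matrix.vecTail]
  · intro h
    rw [lei4_mem_range_iff_basis]
    have c0 := (lei4_mem_center lam hlam _).1 (h ![1, 0, 0])
    have c1 := (lei4_mem_center lam hlam _).1 (h ![0, 1, 0])
    simp [sub_eq_zero] at c0 c1
    refine ⟨(f : (Fin 3 → F) ≃ₗ[F] (Fin 3 → F)) ![1, 0, 0] 2,
      (f : (Fin 3 → F) ≃ₗ[F] (Fin 3 → F)) ![0, 1, 0] 2, ?_, ?_, ?_⟩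
    · ext i; fin_cases i <;> simp [c0]
    · ext i; fin_cases i <;> simp [c1]
    · have hb := f.2 ![1, 0, 0] ![1, 0, 0]
      rw [lei4_bracket_apply, lei4_bracket_apply] at hb
      simpa [c0] using hb

theorem LeibnizAlg.Aut_map_center {F : Type*} [Field F] {L : Type*} [AddCommGroup L]
    [Module F L] (A : LeibnizAlg F L) (g : A.Aut) {x : L} (hx : x ∈ A.center) :
    (g : L ≃ₗ[F] L) x ∈ A.center := by
  obtain ⟨h1, h2⟩ := hx
  refine ⟨fun y => ?_, fun y => ?_⟩
  · have := g.2 x ((g : L ≃ₗ[F] L).symm y)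
    rw [LinearEquiv.apply_symm_apply, h1, map_zero] at this
    exact this.symm
  · have := g.2 ((g : L ≃ₗ[F] L).symm y) x
    rw [LinearEquiv.apply_symm_apply, h2, map_zero] at this
    exact this.symm

/-- for `L = Lei₄(3,F)` and `G = Aut(L)`, the set
`C = C_G(L/ζ(L)) = {f ∈ G : f(x) - x ∈ ζ(L) for all x}` is a normal subgroup of
`G`, consists exactly of the maps `f(a₁) = a₁ + α₃a₃`, `f(a₂) = a₂ + β₃a₃`,
`f(a₃) = a₃`, and is isomorphic to the direct product of two copies of the
additive group of `F`. -/
theorem lei4_central_aut_subgroup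
    (F : Type*) [Field F] (lam : F) (hlam : lam ≠ 0) :
    ∃ C : Subgroup (lei4 F lam).Aut, C.Normal ∧
      (∀ f : (lei4 F lam).Aut, f ∈ C ↔
        ∀ x : Fin 3 → F,
          (f : (Fin 3 → F) ≃ₗ[F] (Fin 3 → F)) x - x ∈ (lei4 F lam).center) ∧
      (∀ f : (lei4 F lam).Aut, f ∈ C ↔
        ∃ α₃ β₃ : F,
          (f : (Fin 3 → F) ≃ₗ[F] (Fin 3 → F)) ![1, 0, 0]
              = ![1, 0, 0] + α₃ • ![0, 0, 1] ∧
          (f : (Fin 3 → F) ≃ₗ[F] (Fin 3 → F)) ![0, 1, 0]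
              = ![0, 1, 0] + β₃ • ![0, 0, 1] ∧
          (f : (Fin 3 → F) ≃ₗ[F] (Fin 3 → F)) ![0, 0, 1] = ![0, 0, 1]) ∧
      Nonempty (C ≃* Multiplicative (F × F)) := by
  refine ⟨(lei4ShiftHom F lam).range, ⟨fun f hf g => ?_⟩,
    lei4_mem_range_iff_center lam hlam, lei4_mem_range_iff_basis lam,
    ⟨((lei4ShiftHom F lam).ofInjective (lei4ShiftHom_injective F lam)).symm⟩⟩
  rw [lei4_mem_range_iff_center lam hlam] at hf ⊢
  intro x
  have h := (lei4 F lam).Aut_map_center g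
    (hf ((g : (Fin 3 → F) ≃ₗ[F] (Fin 3 → F)).symm x))
  rw [map_sub, LinearEquiv.apply_symm_apply] at h
  exact h
end

section
/- Let F be a field, λ ∈ F nonzero, L = Lei₄(3,F), and let f : L → L be the F-linear map determined by f(a₁) = α₁a₁ + α₂a₂ + α₃a₃, f(a₂) = β₁a₁ + β₂a₂ + β₃a₃, f(a₃) = μa₃, where α₁, α₂, α₃, β₁, β₂, β₃, μ ∈ F. Then f([x,y]) = [f(x), f(y)] for all x, y ∈ L if and only if μ = α₁² + λα₂², α₁² + λα₂² = λ⁻¹β₁² + β₂², and α₁β₁ + λα₂β₂ = 0. -/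
/-- for `L = Lei₄(3,F)` with basis `a₁ = ![1,0,0]`, `a₂ = ![0,1,0]`,
`a₃ = ![0,0,1]`, a linear map `f` with `f(a₁) = α₁a₁ + α₂a₂ + α₃a₃`,
`f(a₂) = β₁a₁ + β₂a₂ + β₃a₃`, `f(a₃) = μa₃` preserves the bracket iff
`μ = α₁² + λα₂²`, `α₁² + λα₂² = λ⁻¹β₁² + β₂²` and `α₁β₁ + λα₂β₂ = 0`. -/
theorem lei4_endo_bracket_iff
    (F : Type*) [Field F] (lam : F) (hlam : lam ≠ 0)
    (α₁ α₂ α₃ β₁ β₂ β₃ μ : F)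
    (f : (Fin 3 → F) →ₗ[F] (Fin 3 → F))
    (h1 : f ![1, 0, 0] = α₁ • ![1, 0, 0] + α₂ • ![0, 1, 0] + α₃ • ![0, 0, 1])
    (h2 : f ![0, 1, 0] = β₁ • ![1, 0, 0] + β₂ • ![0, 1, 0] + β₃ • ![0, 0, 1])
    (h3 : f ![0, 0, 1] = μ • ![0, 0, 1]) :
    (∀ x y : Fin 3 → F,
        f ((lei4 F lam).bracket x y) = (lei4 F lam).bracket (f x) (f y)) ↔
    (μ = α₁ ^ 2 + lam * α₂ ^ 2 ∧
      α₁ ^ 2 + lam * α₂ ^ 2 = lam⁻¹ * β₁ ^ 2 + β₂ ^ 2 ∧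
      α₁ * β₁ + lam * α₂ * β₂ = 0) := by
  have hx : ∀ x : Fin 3 → F, x = x 0 • ![1, 0, 0] + x 1 • ![0, 1, 0] + x 2 • ![0, 0, 1] := by
    intro x
    ext i
    fin_cases i <;> simp
  have hf0 : ∀ x : Fin 3 → F, f x 0 = x 0 * α₁ + x 1 * β₁ := by
    intro x
    conv_lhs => rw [hx x]
    simp only [map_add, map_smul, h1, h2, h3]
    simp
  have hf1 : ∀ x : Fin 3 → F, f x 1 = x 0 * α₂ + x 1 * β₂ := by
    intro x
    conv_lhs => rw [hx x]
    simp only [map_add, map_smul, h1, h2, h3]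
    simp
  have hb : ∀ x y : Fin 3 → F, (lei4 F lam).bracket x y =
      (x 0 * y 0 + lam * (x 1 * y 1)) • (![0, 0, 1] : Fin 3 → F) := fun x y => rfl
  have key : ∀ x y : Fin 3 → F,
      (f ((lei4 F lam).bracket x y) = (lei4 F lam).bracket (f x) (f y)) ↔
      (x 0 * y 0 + lam * (x 1 * y 1)) * μ =
        (x 0 * α₁ + x 1 * β₁) * (y 0 * α₁ + y 1 * β₁) +
          lam * ((x 0 * α₂ + x 1 * β₂) * (y 0 * α₂ + y 1 * β₂)) := by
    intro x y
    rw [hb, hb, map_smul, h3, smul_smul, hf0, hf0, hf1, hf1]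
    constructor
    · intro h
      simpa using congrFun h 2
    · intro h
      rw [h]
  simp only [key]
  constructor
  · intro h
    have e1 := h ![1, 0, 0] ![1, 0, 0]
    have e2 := h ![0, 1, 0] ![0, 1, 0]
    have e3 := h ![1, 0, 0] ![0, 1, 0]
    simp at e1 e2 e3
    have hm : μ = α₁ ^ 2 + lam * α₂ ^ 2 := by linear_combination e1
    refine ⟨hm, ?_, by linear_combination -e3⟩
    rw [← hm]
    apply mul_left_cancel₀ hlam
    rw [mul_add, mul_inv_cancel_left₀ hlam]
    linear_combination e2
  · rintro ⟨hm, hq, ho⟩ x y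
    have e2 : lam * μ = β₁ ^ 2 + lam * β₂ ^ 2 := by
      rw [hm, hq, mul_add, mul_inv_cancel_left₀ hlam]
    linear_combination (x 0 * y 0) * hm + (x 1 * y 1) * e2 - (x 0 * y 1 + x 1 * y 0) * ho
end

section
/- Let L be a left Leibniz algebra of dimension 3 over a field F which is not a Lie algebra (there exists a ∈ L with [a,a] ≠ 0), is nilpotent of nilpotency class 2, and has center of dimension 1. Then for any a₁ ∈ L with a₃ := [a₁,a₁] ≠ 0, it holds that a₃ ∈ ζ(L), ζ(L) = Fa₃, and the subspace Fa₁ ⊕ Fa₃ is a 2-dimensional ideal of L. -/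
/-- let `L` be a 3-dimensional left Leibniz algebra which is not a
Lie algebra, is nilpotent of class 2 (`γ₃(L) = A.lower 2 = 0`,
`γ₂(L) = A.lower 1 ≠ 0`) and has 1-dimensional center.  Then for any `a₁` with
`a₃ = [a₁,a₁] ≠ 0` one has `a₃ ∈ ζ(L)`, `ζ(L) = Fa₃`, and
`Fa₁ ⊕ Fa₃ = span {a₁, a₃}` is a 2-dimensional ideal of `L`. -/
theorem dim_three_class_two_structure
    {F : Type*} [Field F] {L : Type*} [AddCommGroup L] [Module F L]
    (A : LeibnizAlg F L)
    (hdim : Module.finrank F L = 3)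
    (hnotlie : ∃ a : L, A.bracket a a ≠ 0)
    (hnil : A.lower 2 = ⊥) (hcl : A.lower 1 ≠ ⊥)
    (hz : Module.finrank F A.center = 1)
    (a₁ : L) (ha : A.bracket a₁ a₁ ≠ 0) :
    A.bracket a₁ a₁ ∈ A.center ∧
    A.center = Submodule.span F {A.bracket a₁ a₁} ∧
    (∀ x : L, ∀ a ∈ Submodule.span F {a₁, A.bracket a₁ a₁},
        A.bracket x a ∈ Submodule.span F {a₁, A.bracket a₁ a₁} ∧
        A.bracket a x ∈ Submodule.span F {a₁, A.bracket a₁ a₁}) ∧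
    Module.finrank F (Submodule.span F {a₁, A.bracket a₁ a₁}) = 2 := by
  have h0 : ∀ x y z : L, A.bracket x (A.bracket y z) = 0 := by
    intro x y z
    have h1 : A.bracket y z ∈ A.lower 1 :=
      Submodule.subset_span ⟨y, z, Submodule.mem_top, rfl⟩
    have h2 : A.bracket x (A.bracket y z) ∈ A.lower 2 :=
      Submodule.subset_span ⟨x, _, h1, rfl⟩
    rw [hnil] at h2
    exact (Submodule.mem_bot F).1 h2
  have hc : ∀ x y : L, A.bracket x y ∈ A.center := by
    intro x y
    refine ⟨fun z => ?_, fun z => h0 z x y⟩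
    rw [A.leibniz, h0, h0, sub_zero]
  have hC : A.center = Submodule.span F {A.bracket a₁ a₁} := by
    apply le_antisymm
    · intro v hv
      obtain ⟨c, hcv⟩ := (finrank_eq_one_iff_of_nonzero'
        (⟨A.bracket a₁ a₁, hc a₁ a₁⟩ : A.center)
        (fun h => ha (congrArg Subtype.val h))).1 hz ⟨v, hv⟩
      exact Submodule.mem_span_singleton.2 ⟨c, congrArg Subtype.val hcv⟩
    · rw [Submodule.span_singleton_le_iff_mem]
      exact hc _ _
  have hsub : ∀ x y : L, A.bracket x y ∈ Submodule.span F {a₁, A.bracket a₁ a₁} := by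
    intro x y
    have h := hc x y
    rw [hC] at h
    exact Submodule.span_mono (by simp) h
  refine ⟨hc _ _, hC, fun x a _ => ⟨hsub _ _, hsub _ _⟩, ?_⟩
  have hli : LinearIndependent F ![a₁, A.bracket a₁ a₁] := by
    rw [LinearIndependent.pair_iff]
    intro s t hst
    have h := congrArg (A.bracket a₁) hst
    simp only [map_add, map_smul, h0, smul_zero, add_zero, map_zero] at h
    have hs : s = 0 := (smul_eq_zero.1 h).resolve_right ha
    subst hs
    simp only [zero_smul, zero_add] at hst
    exact ⟨rfl, (smul_eq_zero.1 hst).resolve_right ha⟩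
  have h := finrank_span_eq_card hli
  rw [Matrix.range_cons_cons_empty, Fintype.card_fin] at h
  exact h
end

section
/- Let L be a left Leibniz algebra of dimension 3 over a field F which is not a Lie algebra, is nilpotent of nilpotency class 2, and has center of dimension 1, and let a₁ ∈ L satisfy [a₁,a₁] ≠ 0. Then the left annihilator Ann^left_L(a₁) = {x ∈ L : [x,a₁] = 0} is a subalgebra of L of dimension 2. -/
/-- let `L` be a 3-dimensional left Leibniz algebra which is not a
Lie algebra, is nilpotent of class 2 and has 1-dimensional center, and let
`a₁ ∈ L` with `[a₁,a₁] ≠ 0`.  Then the left annihilator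
`Ann^left_L(a₁) = {x : [x,a₁] = 0} = ker (x ↦ [x,a₁])` is a subalgebra of
dimension 2. -/
theorem left_annihilator_is_two_dim_subalgebra
    {F : Type*} [Field F] {L : Type*} [AddCommGroup L] [Module F L]
    (A : LeibnizAlg F L)
    (hdim : Module.finrank F L = 3)
    (hnotlie : ∃ a : L, A.bracket a a ≠ 0)
    (hnil : A.lower 2 = ⊥) (hcl : A.lower 1 ≠ ⊥)
    (hz : Module.finrank F A.center = 1)
    (a₁ : L) (ha : A.bracket a₁ a₁ ≠ 0) :
    (∀ x ∈ LinearMap.ker (A.bracket.flip a₁), ∀ y ∈ LinearMap.ker (A.bracket.flip a₁),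
        A.bracket x y ∈ LinearMap.ker (A.bracket.flip a₁)) ∧
    Module.finrank F (LinearMap.ker (A.bracket.flip a₁)) = 2 := by
  have h1 : ∀ x y z : L, A.bracket x (A.bracket y z) = 0 := by
    intro x y z
    have hm : A.bracket x (A.bracket y z) ∈ A.lower 2 :=
      Submodule.subset_span ⟨x, A.bracket y z,
        Submodule.subset_span ⟨y, z, Submodule.mem_top, rfl⟩, rfl⟩
    rw [hnil] at hm
    exact (Submodule.mem_bot F).1 hm
  have h2 : ∀ x y z : L, A.bracket (A.bracket x y) z = 0 := by
    intro x y z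
    rw [A.leibniz, h1, h1, sub_zero]
  have hfin : FiniteDimensional F L := Module.finite_of_finrank_pos (by omega)
  have hle : LinearMap.range (A.bracket.flip a₁) ≤ A.center := by
    rintro _ ⟨x, rfl⟩
    exact ⟨fun y => h2 x a₁ y, fun y => h1 y x a₁⟩
  have hr1 := Submodule.finrank_mono hle
  have hr2 : 0 < Module.finrank F (LinearMap.range (A.bracket.flip a₁)) := by
    rw [Nat.pos_iff_ne_zero]
    intro h0
    rw [Submodule.finrank_eq_zero] at h0
    have hm : A.bracket a₁ a₁ ∈ LinearMap.range (A.bracket.flip a₁) := ⟨a₁, rfl⟩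
    rw [h0] at hm
    exact ha ((Submodule.mem_bot F).1 hm)
  have hrk := LinearMap.finrank_range_add_finrank_ker (A.bracket.flip a₁)
  refine ⟨?_, ?_⟩
  · intro x hx y hy
    exact h2 x y a₁
  · omega
end

section
/- Let L be a left Leibniz algebra of dimension 3 over a field F which is not a Lie algebra, is nilpotent of nilpotency class 2, and has center of dimension 1. Let a₁ ∈ L with a₃ := [a₁,a₁] ≠ 0, and suppose the subalgebra B = Ann^left_L(a₁) = {x ∈ L : [x,a₁] = 0} is non-abelian and is generated as an algebra by an element b satisfying [a₁,b] = 0. Then there exists a nonzero λ ∈ F such that (a₁, b, a₃) is a basis of L with [a₁,a₁] = a₃, [b,b] = λa₃, and [a₁,b] = [b,a₁] = [a₁,a₃] = [b,a₃] = [a₃,a₁] = [a₃,b] = [a₃,a₃] = 0; that is, L is isomorphic to Lei₄(3,F). -/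
/-- let `L` be a 3-dimensional left Leibniz algebra which is not a
Lie algebra, is nilpotent of class 2 and has 1-dimensional center, let `a₁ ∈ L`
with `a₃ = [a₁,a₁] ≠ 0`, and suppose the left annihilator
`B = Ann^left_L(a₁) = ker (x ↦ [x,a₁])` is non-abelian and is generated as an
algebra by an element `b` with `[a₁,b] = 0`.  Then for some `λ ≠ 0`,
`(a₁, b, a₃)` is a basis of `L` with `[a₁,a₁] = a₃`, `[b,b] = λa₃` and all other
brackets of basis vectors zero; i.e. `L ≅ Lei₄(3,F)`. -/
theorem dim_three_class_two_nonabelian_annihilator_is_lei4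
    {F : Type*} [Field F] {L : Type*} [AddCommGroup L] [Module F L]
    (A : LeibnizAlg F L)
    (hdim : Module.finrank F L = 3)
    (hnotlie : ∃ a : L, A.bracket a a ≠ 0)
    (hnil : A.lower 2 = ⊥) (hcl : A.lower 1 ≠ ⊥)
    (hz : Module.finrank F A.center = 1)
    (a₁ : L) (ha : A.bracket a₁ a₁ ≠ 0)
    (hnonab : ∃ x ∈ LinearMap.ker (A.bracket.flip a₁),
        ∃ y ∈ LinearMap.ker (A.bracket.flip a₁), A.bracket x y ≠ 0)
    (b : L) (hba : A.bracket a₁ b = 0)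
    (hgen : LinearMap.ker (A.bracket.flip a₁) = A.genBy b) :
    ∃ lam : F, lam ≠ 0 ∧
      LinearIndependent F ![a₁, b, A.bracket a₁ a₁] ∧
      Submodule.span F {a₁, b, A.bracket a₁ a₁} = ⊤ ∧
      A.bracket b b = lam • A.bracket a₁ a₁ ∧
      A.bracket a₁ b = 0 ∧ A.bracket b a₁ = 0 ∧
      A.bracket a₁ (A.bracket a₁ a₁) = 0 ∧
      A.bracket b (A.bracket a₁ a₁) = 0 ∧
      A.bracket (A.bracket a₁ a₁) a₁ = 0 ∧
      A.bracket (A.bracket a₁ a₁) b = 0 ∧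
      A.bracket (A.bracket a₁ a₁) (A.bracket a₁ a₁) = 0 := by
  have h1 : ∀ x y : L, A.bracket x y ∈ A.lower 1 := fun x y =>
    Submodule.subset_span ⟨x, y, Submodule.mem_top, rfl⟩
  have hr : ∀ x y z : L, A.bracket x (A.bracket y z) = 0 := by
    intro x y z
    have : A.bracket x (A.bracket y z) ∈ A.lower 2 :=
      Submodule.subset_span ⟨x, _, h1 y z, rfl⟩
    rw [hnil] at this
    simpa using this
  have hl : ∀ x y z : L, A.bracket (A.bracket x y) z = 0 := by
    intro x y z
    rw [A.leibniz, hr, hr, sub_zero]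
  have hc : ∀ x y : L, A.bracket x y ∈ A.center := fun x y =>
    ⟨fun z => hl x y z, fun z => hr z x y⟩
  have hsm : ∀ x y : L, ∃ c : F, c • A.bracket a₁ a₁ = A.bracket x y := by
    intro x y
    have hne : (⟨A.bracket a₁ a₁, hc a₁ a₁⟩ : A.center) ≠ 0 := by
      intro h
      exact ha (congrArg Subtype.val h)
    obtain ⟨c, hcc⟩ := (finrank_eq_one_iff_of_nonzero' _ hne).1 hz ⟨A.bracket x y, hc x y⟩
    exact ⟨c, congrArg Subtype.val hcc⟩
  have hb : A.bracket b a₁ = 0 := by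
    have : b ∈ LinearMap.ker (A.bracket.flip a₁) := by
      rw [hgen]
      exact (Submodule.mem_sInf).2 fun S hS => hS.1
    simpa using this
  have hbb : A.bracket b b ≠ 0 := by
    intro h0
    have hz0 : ∀ x ∈ Submodule.span F {b}, ∀ y ∈ Submodule.span F {b},
        A.bracket x y = 0 := by
      intro x hx y hy
      obtain ⟨c, rfl⟩ := Submodule.mem_span_singleton.1 hx
      obtain ⟨d, rfl⟩ := Submodule.mem_span_singleton.1 hy
      simp [h0]
    have hle : A.genBy b ≤ Submodule.span F {b} := by
      refine sInf_le ⟨Submodule.mem_span_singleton_self b, ?_⟩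
      intro x hx y hy
      rw [hz0 x hx y hy]
      exact Submodule.zero_mem _
    obtain ⟨x, hx, y, hy, hxy⟩ := hnonab
    rw [hgen] at hx hy
    exact hxy (hz0 x (hle hx) y (hle hy))
  obtain ⟨lam, hlam⟩ := hsm b b
  have hlin : LinearIndependent F ![a₁, b, A.bracket a₁ a₁] := by
    rw [Fintype.linearIndependent_iff]
    intro g hg
    simp only [Fin.sum_univ_three, Matrix.cons_val_zero, Matrix.cons_val_one,
      Matrix.cons_val] at hg
    have e0 : g 0 = 0 := by
      have := congrArg (A.bracket a₁) hg
      simpa [hba, hr, ha] using this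
    have e1 : g 1 = 0 := by
      have := congrArg (A.bracket b) hg
      simpa [hb, hr, hbb] using this
    have e2 : g 2 = 0 := by
      simpa [e0, e1, ha] using hg
    intro i
    fin_cases i
    · exact e0
    · exact e1
    · exact e2
  refine ⟨lam, ?_, hlin, ?_, hlam.symm, hba, hb, hr _ _ _, hr _ _ _, hl _ _ _, hl _ _ _,
    hl _ _ _⟩
  · rintro rfl
    exact hbb (by rw [← hlam, zero_smul])
  · have := hlin.span_eq_top_of_card_eq_finrank (by simp [hdim])
    rw [← this]
    congr 1
    ext x
    simp [eq_comm]
    tauto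
end
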